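/- arXiv:1707.07475 — 3 statements merged into one kernel-verified Lean document; each statement's English description precedes it below -/
import Mathlib

section
/- Let x = (x_n) be a sequence taking values in a separable metric space. Then the set {ω ∈ (0,1] : Λ_x(I_0) = Λ_{x↾ω}(I_0)} has Lebesgue measure 1; that is, the set of statistical limit points of x equals the set of statistical limit points of almost every subsequence of x (in the sense of Lebesgue measure). -/
open Filter Topology MeasureTheory Set

noncomputable section

/-- A lower semicontinuous submeasure on `ℕ`:  `φ : P(ℕ) → [0,∞]` with `φ(∅) = 0`,
`φ({n}) < ∞`, monotone, subadditive, and `φ(A) = lim_n φ(A ∩ {0,…,n-1})`. -/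
structure LSCSubmeasure where
  toFun : Set ℕ → ENNReal
  empty' : toFun ∅ = 0
  singleton_lt_top' : ∀ n : ℕ, toFun {n} < ⊤
  mono' : ∀ ⦃A B : Set ℕ⦄, A ⊆ B → toFun A ≤ toFun B
  subadd' : ∀ A B : Set ℕ, toFun (A ∪ B) ≤ toFun A + toFun B
  lsc' : ∀ A : Set ℕ, Tendsto (fun n => toFun (A ∩ {m | m < n})) atTop (𝓝 (toFun A))

/-- `‖A‖_φ := lim_n φ(A \ {0,…,n-1})`; since the sequence is antitone, the limit
is the infimum. -/
def LSCSubmeasure.norm (φ : LSCSubmeasure) (A : Set ℕ) : ENNReal :=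
  ⨅ n : ℕ, φ.toFun (A \ {m | m < n})

/-- The (analytic P-)ideal `I_φ = {A : ‖A‖_φ = 0}` associated with `φ`. -/
def LSCSubmeasure.ideal (φ : LSCSubmeasure) : Set (Set ℕ) :=
  {A | φ.norm A = 0}

/-- `I` is an ideal on `ℕ`: closed under finite unions and subsets, contains all
finite sets, and is proper. -/
def IsIdealOnNat (I : Set (Set ℕ)) : Prop :=
  (∀ A B : Set ℕ, A ∈ I → B ∈ I → A ∪ B ∈ I) ∧
  (∀ A B : Set ℕ, A ⊆ B → B ∈ I → A ∈ I) ∧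
  (∀ A : Set ℕ, A.Finite → A ∈ I) ∧
  (Set.univ : Set ℕ) ∉ I

/-- Convergence of the subsequence `(x_n : n ∈ A)` to `l`. -/
def ConvergesAlong {X : Type*} [TopologicalSpace X] (x : ℕ → X) (A : Set ℕ) (l : X) : Prop :=
  Tendsto x (atTop ⊓ 𝓟 A) (𝓝 l)

/-- `Λ_x(I)`: the set of `I`-limit points of the sequence `x`. -/
def idealLimitPoints {X : Type*} [TopologicalSpace X] (I : Set (Set ℕ)) (x : ℕ → X) : Set X :=
  {l | ∃ A : Set ℕ, A ∉ I ∧ ConvergesAlong x A l}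

/-- `Γ_x(I)`: the set of `I`-cluster points of the sequence `x`. -/
def idealClusterPoints {X : Type*} [TopologicalSpace X] (I : Set (Set ℕ)) (x : ℕ → X) : Set X :=
  {l | ∀ U ∈ 𝓝 l, {n | x n ∈ U} ∉ I}

/-- `Λ_x(I_φ, q)`: the set of `ℓ` such that some subsequence `(x_n : n ∈ A)` with
`‖A‖_φ ≥ q` converges to `ℓ`. -/
def LambdaQ {X : Type*} [TopologicalSpace X] (φ : LSCSubmeasure) (x : ℕ → X) (q : ℝ) : Set X :=
  {l | ∃ A : Set ℕ, ENNReal.ofReal q ≤ φ.norm A ∧ ConvergesAlong x A l}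

/-- The summable ideal `I_f = {S : ∑_{n ∈ S} f(n) < ∞}`. -/
def summableIdeal (f : ℕ → ℝ) : Set (Set ℕ) := {S | Summable (S.indicator f)}

/-- `A` has asymptotic density `d`. -/
def HasDensity (A : Set ℕ) (d : ℝ) : Prop :=
  Tendsto (fun n => (∑ i ∈ Finset.range n, A.indicator (fun _ => (1 : ℝ)) i) / (n : ℝ))
    atTop (𝓝 d)

/-- `A_B := {a_b : b ∈ B}`, where `a_0 < a_1 < ⋯` is the increasing enumeration of `A`. -/
def sel (A B : Set ℕ) : Set ℕ := (fun b => Nat.nth (· ∈ A) b) '' B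

/-- `A ≤ B`: the increasing enumerations satisfy `a_n ≤ b_n` for all `n`. -/
def enumLE (A B : Set ℕ) : Prop := ∀ n : ℕ, Nat.nth (· ∈ A) n ≤ Nat.nth (· ∈ B) n

/-- `I` is weakly thinnable: `A_B ∉ I` whenever `A` has non-zero asymptotic density
and `B ∉ I`. -/
def WeaklyThinnable (I : Set (Set ℕ)) : Prop :=
  ∀ A B : Set ℕ, (∃ d : ℝ, 0 < d ∧ HasDensity A d) → B ∉ I → sel A B ∉ I

/-- `I` is thinnable: weakly thinnable, and moreover `B_A ∉ I` under the same
hypotheses, and `X ∉ I` whenever `X ≤ Y` and `Y ∉ I`. -/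
def Thinnable (I : Set (Set ℕ)) : Prop :=
  WeaklyThinnable I ∧
  (∀ A B : Set ℕ, (∃ d : ℝ, 0 < d ∧ HasDensity A d) → B ∉ I → sel B A ∉ I) ∧
  (∀ X Y : Set ℕ, enumLE X Y → Y ∉ I → X ∉ I)

/-- The analytic P-ideal `I_φ` is strongly thinnable. -/
def StronglyThinnable (φ : LSCSubmeasure) : Prop :=
  WeaklyThinnable φ.ideal ∧
  (∀ q : ℝ, 0 < q → ∀ A : Set ℕ, ∀ a : ℝ, 0 < a → HasDensity A a →
    ∃ c : ℝ, 0 < c ∧ ∀ B : Set ℕ, ENNReal.ofReal q ≤ φ.norm B →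
      ENNReal.ofReal (c * q) ≤ φ.norm (sel B A)) ∧
  (∃ c : ℝ, 0 < c ∧ ∀ X Y : Set ℕ, enumLE X Y →
    ENNReal.ofReal c * φ.norm Y ≤ φ.norm X)

/-- The `i`-th digit (0-indexed, so this is `d_{i+1}(ω)`) of the non-terminating
dyadic expansion of `ω ∈ (0,1]`. -/
def dyadicDigit (ω : ℝ) (i : ℕ) : ℕ :=
  (⌈(2 : ℝ) ^ (i + 1) * ω⌉ - 2 * ⌈(2 : ℝ) ^ i * ω⌉ + 1).toNat

/-- `x↾ω`: the subsequence of `x` indexed by the set `{i : d_i(ω) = 1}`. -/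
def subseq {X : Type*} (x : ℕ → X) (ω : ℝ) : ℕ → X :=
  fun k => x (Nat.nth (fun i => dyadicDigit ω i = 1) k)

/-- The Erdős–Ulam ideal `E_f` associated with a weight `f`. -/
def ErdosUlamIdeal (f : ℕ → ℝ) : Set (Set ℕ) :=
  {S | Tendsto (fun n => (∑ i ∈ Finset.Icc 1 n, S.indicator f i) /
        (∑ i ∈ Finset.Icc 1 n, f i)) atTop (𝓝 0)}

/-- The upper `α`-density `d_α^⋆(S)`. -/
def upperAlphaDensity (α : ℝ) (S : Set ℕ) : ℝ :=
  limsup (fun n => (∑ i ∈ Finset.Icc 1 n, S.indicator (fun i => (i : ℝ) ^ α) i) /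
    (∑ i ∈ Finset.Icc 1 n, (i : ℝ) ^ α)) atTop

/-- `S` has `α`-asymptotic density `d`. -/
def HasAlphaDensity (α : ℝ) (S : Set ℕ) (d : ℝ) : Prop :=
  Tendsto (fun n => (∑ i ∈ Finset.Icc 1 n, S.indicator (fun i => (i : ℝ) ^ α) i) /
    (∑ i ∈ Finset.Icc 1 n, (i : ℝ) ^ α)) atTop (𝓝 d)

/-- The ideal `I_α` of sets of zero upper `α`-density. -/
def Ialpha (α : ℝ) : Set (Set ℕ) := {S | upperAlphaDensity α S = 0}


open Classical in
/-- counting function -/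
def cntN (S : Set ℕ) (n : ℕ) : ℕ := Nat.count (· ∈ S) n

theorem cntN_zero (S : Set ℕ) : cntN S 0 = 0 := by simp [cntN]
theorem cntN_succ (S : Set ℕ) (n : ℕ) [Decidable (n ∈ S)] :
    cntN S (n+1) = cntN S n + if n ∈ S then 1 else 0 := by
  unfold cntN; rw [Nat.count_succ]; congr

theorem cntN_le (S : Set ℕ) (n : ℕ) : cntN S n ≤ n := by
  unfold cntN; classical exact Nat.count_le _

theorem cntN_mono_set {S T : Set ℕ} (h : S ⊆ T) (n : ℕ) : cntN S n ≤ cntN T n := by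
  unfold cntN; classical exact Nat.count_mono_left (fun _ _ hk => h hk)

theorem cntN_mono_lt {S T : Set ℕ} {n : ℕ} (h : ∀ i < n, i ∈ S → i ∈ T) :
    cntN S n ≤ cntN T n := by
  unfold cntN; classical exact Nat.count_mono_left h

theorem cntN_eq_sum (S : Set ℕ) (n : ℕ) :
    (cntN S n : ℝ) = ∑ i ∈ Finset.range n, S.indicator (fun _ => (1 : ℝ)) i := by
  classical
  induction n with
  | zero => simp [cntN_zero]
  | succ n ih =>
    rw [cntN_succ, Finset.sum_range_succ, ← ih]
    by_cases h : n ∈ S <;> simp [h]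

theorem not_hasDensity_zero (S : Set ℕ) :
    ¬ HasDensity S 0 ↔ ∃ q : ℝ, 0 < q ∧ ∃ᶠ n : ℕ in atTop, q * (n : ℝ) ≤ cntN S n := by
  unfold HasDensity
  simp_rw [← cntN_eq_sum]
  constructor
  · intro h
    by_contra! hq
    apply h
    rw [Metric.tendsto_atTop']
    intro ε hε
    have := hq ε hε
    rw [eventually_atTop] at this
    obtain ⟨N, hN⟩ := this
    refine ⟨N, fun n hn => ?_⟩
    have hn0 : (0:ℝ) < n := by exact_mod_cast (by omega : 0 < n)
    rw [Real.dist_eq, sub_zero, abs_of_nonneg (by positivity), div_lt_iff₀ hn0]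
    exact hN n hn.le
  · rintro ⟨q, hq, hf⟩ h
    have h1 := h.eventually (gt_mem_nhds hq)
    obtain ⟨n, h2, h3, h4⟩ := (hf.and_eventually (h1.and (eventually_gt_atTop 0))).exists
    have hn0 : (0:ℝ) < n := by exact_mod_cast h4
    rw [div_lt_iff₀ hn0] at h3
    linarith

theorem cntN_union_le (S T : Set ℕ) (n : ℕ) : cntN (S ∪ T) n ≤ cntN S n + cntN T n := by
  classical
  induction n with
  | zero => simp [cntN_zero]
  | succ n ih =>
    simp only [cntN_succ]
    by_cases h : n ∈ S <;> by_cases h' : n ∈ T <;> simp [h, h'] <;> omega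

theorem cntN_Iio_le (N n : ℕ) : cntN {i | i < N} n ≤ N := by
  classical
  induction n with
  | zero => simp [cntN_zero]
  | succ n ih =>
    have := cntN_le {i | i < N} n
    rw [cntN_succ]
    by_cases h : n < N <;> simp [h] <;> omega

/-- Characterisation of statistical limit points. -/
theorem mem_limitPoints_iff {X : Type*} [MetricSpace X] (x : ℕ → X) (l : X) :
    l ∈ idealLimitPoints {S : Set ℕ | HasDensity S 0} x ↔
    ∃ q : ℝ, 0 < q ∧ ∀ U ∈ 𝓝 l, ∃ᶠ n : ℕ in atTop, q * (n : ℝ) ≤ cntN {i | x i ∈ U} n := by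
  constructor
  · rintro ⟨A, hA, hc⟩
    obtain ⟨q, hq, hf⟩ := (not_hasDensity_zero A).1 hA
    refine ⟨q / 2, by positivity, fun U hU => ?_⟩
    have h1 := hc hU
    rw [mem_map, mem_inf_principal, mem_atTop_sets] at h1
    obtain ⟨N, hN⟩ := h1
    have h2 : A ⊆ {i | x i ∈ U} ∪ {i | i < N} := by
      intro i hi
      by_cases h : i < N
      · exact Or.inr h
      · exact Or.inl (hN i (by omega) hi)
    have h3 : ∀ᶠ n : ℕ in atTop, (N : ℝ) ≤ q / 2 * n :=
      (tendsto_natCast_atTop_atTop.const_mul_atTop (by positivity)).eventually_ge_atTop _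
    refine (hf.and_eventually h3).mono ?_
    rintro n ⟨h4, h5⟩
    have h6 : cntN A n ≤ cntN {i | x i ∈ U} n + N :=
      (cntN_mono_set h2 n).trans ((cntN_union_le _ _ n).trans
        (Nat.add_le_add_left (cntN_Iio_le N n) _))
    have h7 : (cntN A n : ℝ) ≤ cntN {i | x i ∈ U} n + N := by exact_mod_cast h6
    linarith
  · rintro ⟨q, hq, hU⟩
    have key : ∀ k N : ℕ, ∃ n : ℕ, N < n ∧ q / 2 * (n : ℝ) ≤
        cntN {i | N ≤ i ∧ x i ∈ Metric.ball l (1 / ((k : ℝ) + 1))} n := by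
      intro k N
      have h3 : ∀ᶠ n : ℕ in atTop, (N : ℝ) ≤ q / 2 * n :=
        (tendsto_natCast_atTop_atTop.const_mul_atTop (by positivity)).eventually_ge_atTop _
      obtain ⟨n, h4, h5, h6⟩ := ((hU _ (Metric.ball_mem_nhds l
        (by positivity : (0:ℝ) < 1 / ((k : ℝ) + 1)))).and_eventually
          (h3.and (eventually_gt_atTop N))).exists
      refine ⟨n, h6, ?_⟩
      have h2 : {i | x i ∈ Metric.ball l (1 / ((k : ℝ) + 1))} ⊆
          {i | N ≤ i ∧ x i ∈ Metric.ball l (1 / ((k : ℝ) + 1))} ∪ {i | i < N} := by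
        intro i hi
        by_cases h : i < N
        · exact Or.inr h
        · exact Or.inl ⟨by omega, hi⟩
      have h7 := (cntN_mono_set h2 n).trans ((cntN_union_le _ _ n).trans
        (Nat.add_le_add_left (cntN_Iio_le N n) _))
      have h8 : (cntN {i | x i ∈ Metric.ball l (1 / ((k : ℝ) + 1))} n : ℝ) ≤
        cntN {i | N ≤ i ∧ x i ∈ Metric.ball l (1 / ((k : ℝ) + 1))} n + N := by exact_mod_cast h7
      linarith
    choose f hf1 hf2 using key
    obtain ⟨g, hg⟩ : ∃ g : ℕ → ℕ, ∀ k, g (k+1) = f k (g k) :=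
      ⟨fun k => Nat.rec 0 (fun k N => f k N) k, fun k => rfl⟩
    have hmono : StrictMono g := strictMono_nat_of_lt_succ fun k => by rw [hg]; exact hf1 _ _
    refine ⟨{i | ∃ k, g k ≤ i ∧ i < g (k+1) ∧ x i ∈ Metric.ball l (1 / ((k : ℝ) + 1))}, ?_, ?_⟩
    · change ¬ HasDensity _ 0
      rw [not_hasDensity_zero]
      refine ⟨q / 2, by positivity, ?_⟩
      rw [frequently_atTop]
      intro N
      refine ⟨g (N+1), (Nat.le_succ N).trans hmono.le_apply, ?_⟩
      have := hf2 N (g N)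
      rw [← hg] at this
      refine this.trans ?_
      refine Nat.cast_le.2 (cntN_mono_lt fun i hi h => ?_)
      exact ⟨N, h.1, hi, h.2⟩
    · unfold ConvergesAlong
      rw [Metric.tendsto_nhds]
      intro ε hε
      obtain ⟨K, hK⟩ := exists_nat_one_div_lt hε
      rw [eventually_inf_principal]
      filter_upwards [eventually_ge_atTop (g K)] with i hi
      rintro ⟨k, h1, h2, h3⟩
      have hk : K ≤ k := by
        have := hmono.lt_iff_lt.1 (lt_of_le_of_lt hi h2 : g K < g (k+1))
        omega
      refine (Metric.mem_ball.1 h3).trans_le (le_trans ?_ hK.le)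
      have : (K:ℝ) ≤ k := by exact_mod_cast hk
      gcongr

theorem cntN_subseq (D S : Set ℕ) (n : ℕ) :
    cntN {k | Nat.nth (· ∈ D) k ∈ S} (cntN D n) = cntN (D ∩ S) n := by
  classical
  induction n with
  | zero => simp [cntN_zero]
  | succ n ih =>
    rw [cntN_succ D, cntN_succ (D ∩ S)]
    by_cases h : n ∈ D
    · have h1 : Nat.nth (· ∈ D) (cntN D n) = n := by
        unfold cntN; exact Nat.nth_count (p := (· ∈ D)) h
      rw [if_pos h, cntN_succ, ih]
      simp [h, h1]
    · simp [h, ih]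

/-- Deterministic part. -/
theorem limitPoints_eq {X : Type*} [MetricSpace X] (x : ℕ → X) (D : Set ℕ) (B : Set (Set X))
    (hB : TopologicalSpace.IsTopologicalBasis B)
    (hD : Tendsto (fun n : ℕ => ((cntN D n : ℝ) - n / 2) / n) atTop (𝓝 0))
    (hDB : ∀ U ∈ B, Tendsto (fun n : ℕ => ((cntN (D ∩ {i | x i ∈ U}) n : ℝ) -
      cntN {i | x i ∈ U} n / 2) / n) atTop (𝓝 0)) :
    idealLimitPoints {S : Set ℕ | HasDensity S 0} x
      = idealLimitPoints {S : Set ℕ | HasDensity S 0} (fun k => x (Nat.nth (· ∈ D) k)) := by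
  have hDlow : ∀ᶠ n : ℕ in atTop, (n:ℝ) / 4 ≤ cntN D n := by
    filter_upwards [hD.eventually (lt_mem_nhds (by norm_num : (-1/4 : ℝ) < 0)),
      eventually_gt_atTop 0] with n h1 h2
    have hn0 : (0:ℝ) < n := by exact_mod_cast h2
    rw [lt_div_iff₀ hn0] at h1
    linarith
  have hDtop : Tendsto (fun n => cntN D n) atTop atTop := by
    rw [← tendsto_natCast_atTop_iff (R := ℝ)]
    exact tendsto_atTop_mono' _ hDlow (tendsto_natCast_atTop_atTop.atTop_div_const (by norm_num))
  have hDinf : (Set.ofPred (· ∈ D)).Infinite := by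
    intro hfin
    obtain ⟨N, hN⟩ := hfin.bddAbove
    have hsub : D ⊆ {i | i < N + 1} := fun i hi => Nat.lt_succ_of_le (hN hi)
    obtain ⟨n, hn⟩ := (hDtop.eventually_gt_atTop (N+1)).exists
    have := (cntN_mono_set hsub n).trans (cntN_Iio_le (N+1) n)
    omega
  ext l
  rw [mem_limitPoints_iff, mem_limitPoints_iff]
  constructor
  · rintro ⟨q, hq, h⟩
    refine ⟨q / 4, by positivity, fun V hV => ?_⟩
    obtain ⟨U, hUB, hlU, hUV⟩ := hB.mem_nhds_iff.1 hV
    have h1 := (hDB U hUB).eventually (lt_mem_nhds (by linarith : (-q/4 : ℝ) < 0))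
    have h2 := (h U ((hB.isOpen hUB).mem_nhds hlU)).and_eventually
      (h1.and (eventually_gt_atTop 0))
    refine hDtop.frequently (h2.mono ?_)
    rintro n ⟨h3, h4, h5⟩
    have hn0 : (0:ℝ) < n := by exact_mod_cast h5
    rw [lt_div_iff₀ hn0, ← cntN_subseq] at h4
    have h6 : (cntN D n : ℝ) ≤ n := by exact_mod_cast cntN_le D n
    have h7 : (cntN {k | Nat.nth (· ∈ D) k ∈ {i | x i ∈ U}} (cntN D n) : ℝ) ≤
        cntN {k | x (Nat.nth (· ∈ D) k) ∈ V} (cntN D n) := by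
      exact_mod_cast cntN_mono_set (fun k hk => hUV hk) _
    nlinarith
  · rintro ⟨q, hq, h⟩
    refine ⟨q / 4, by positivity, fun V hV => ?_⟩
    have htop : Tendsto (Nat.nth (· ∈ D)) atTop atTop :=
      (Nat.nth_strictMono hDinf).tendsto_atTop
    refine htop.frequently (((h V hV).and_eventually (htop.eventually hDlow)).mono ?_)
    rintro m ⟨h1, h2⟩
    have h3 : cntN D (Nat.nth (· ∈ D) m) = m := by
      unfold cntN; classical exact Nat.count_nth_of_infinite hDinf m
    have h4 := cntN_subseq D {i | x i ∈ V} (Nat.nth (· ∈ D) m)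
    rw [h3] at h4 h2
    have h5 : (cntN {k | x (Nat.nth (· ∈ D) k) ∈ V} m : ℝ) ≤
        cntN {i | x i ∈ V} (Nat.nth (· ∈ D) m) := by
      have := h4.le.trans (cntN_mono_set inter_subset_right _)
      exact_mod_cast this
    nlinarith

/-- Rademacher functions -/
def rad (i : ℕ) (ω : ℝ) : ℝ := if Even ⌈(2:ℝ) ^ (i+1) * ω⌉ then 1 else -1

theorem digit_eq_one_iff (i : ℕ) (ω : ℝ) :
    dyadicDigit ω i = 1 ↔ Even ⌈(2:ℝ) ^ (i+1) * ω⌉ := by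
  unfold dyadicDigit
  have h0 : (2:ℝ) ^ (i+1) * ω = 2 * ((2:ℝ)^i * ω) := by ring
  rw [h0]
  generalize (2:ℝ)^i * ω = y
  have h1 : ⌈2 * y⌉ ≤ 2 * ⌈y⌉ := by
    rw [Int.ceil_le]; push_cast; linarith [Int.le_ceil y]
  have h2 : 2 * ⌈y⌉ - 2 < ⌈2 * y⌉ := by
    rw [Int.lt_ceil]; push_cast; linarith [Int.ceil_lt_add_one y]
  rw [Int.even_iff]
  omega

theorem rad_add_self (i : ℕ) (ω : ℝ) : rad i (ω + (1/2)^(i+1)) = - rad i ω := by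
  unfold rad
  have : (2:ℝ)^(i+1) * (ω + (1/2)^(i+1)) = (2:ℝ)^(i+1) * ω + 1 := by
    rw [mul_add, ← mul_pow]; norm_num
  rw [this, Int.ceil_add_one]
  simp only [Int.even_add_one]
  split_ifs <;> simp

theorem rad_add_lt {i j : ℕ} (h : i < j) (ω : ℝ) : rad j (ω + (1/2)^(i+1)) = rad j ω := by
  unfold rad
  obtain ⟨k, rfl⟩ := Nat.exists_eq_add_of_lt h
  have : (2:ℝ)^(i+k+1+1) * (ω + (1/2)^(i+1)) = (2:ℝ)^(i+k+1+1) * ω + ((2 * 2^k : ℤ) : ℝ) := by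
    rw [mul_add, show i+k+1+1 = (i+1) + (k+1) by ring, pow_add, mul_comm _ ((2:ℝ)^(k+1)),
      mul_assoc ((2:ℝ)^(k+1)) ((2:ℝ)^(i+1)) ((1/2)^(i+1)), ← mul_pow]
    push_cast
    norm_num
    ring
  rw [this, Int.ceil_add_intCast]
  simp [Int.even_add]

theorem rad_periodic (i : ℕ) : Function.Periodic (rad i) 1 := by
  intro ω
  unfold rad
  have : (2:ℝ)^(i+1) * (ω + 1) = (2:ℝ)^(i+1) * ω + ((2 * 2^i : ℤ) : ℝ) := by
    push_cast; ring
  rw [this, Int.ceil_add_intCast]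
  simp [Int.even_add]

theorem rad_mul_self (i : ℕ) (ω : ℝ) : rad i ω * rad i ω = 1 := by
  unfold rad; split_ifs <;> norm_num

theorem abs_rad (i : ℕ) (ω : ℝ) : |rad i ω| = 1 := by
  unfold rad; split_ifs <;> norm_num

theorem rad_measurable (i : ℕ) : Measurable (rad i) := by
  unfold rad
  refine Measurable.ite ?_ measurable_const measurable_const
  have : Measurable (fun ω : ℝ => ⌈(2:ℝ) ^ (i+1) * ω⌉) :=
    Int.measurable_ceil.comp (measurable_const_mul _)
  exact this (MeasurableSet.of_discrete (s := {z : ℤ | Even z}))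

theorem rad_orth_lt {i j : ℕ} (h : i < j) : ∫ ω in (0:ℝ)..1, rad i ω * rad j ω = 0 := by
  have hp : Function.Periodic (fun ω => rad i ω * rad j ω) 1 :=
    (rad_periodic i).mul (rad_periodic j)
  have h1 := hp.intervalIntegral_add_eq 0 ((1/2)^(i+1))
  have h2 : ∫ ω in (0:ℝ)..1, rad i (ω + (1/2)^(i+1)) * rad j (ω + (1/2)^(i+1)) =
      ∫ ω in (0 + (1/2)^(i+1))..(1 + (1/2)^(i+1)), rad i ω * rad j ω :=
    intervalIntegral.integral_comp_add_right (fun ω => rad i ω * rad j ω) _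
  simp only [rad_add_self, rad_add_lt h, neg_mul, intervalIntegral.integral_neg] at h2
  simp only [zero_add, add_comm ((1/2:ℝ)^(i+1)) 1] at h1 h2
  linarith

theorem rad_orth (i j : ℕ) : ∫ ω in (0:ℝ)..1, rad i ω * rad j ω = if i = j then 1 else 0 := by
  rcases lt_trichotomy i j with h | h | h
  · rw [rad_orth_lt h, if_neg h.ne]
  · subst h; simp [rad_mul_self]
  · simp_rw [mul_comm (rad i _)]; rw [rad_orth_lt h, if_neg h.ne']

/-- weighted partial sums -/
def radSum (a : ℕ → ℝ) (n : ℕ) (ω : ℝ) : ℝ := ∑ i ∈ Finset.range n, a i * rad i ω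

theorem radSum_measurable (a : ℕ → ℝ) (n : ℕ) : Measurable (radSum a n) := by
  unfold radSum
  exact Finset.measurable_sum _ fun i _ => (rad_measurable i).const_mul _

theorem rad_mul_intervalIntegrable (i j : ℕ) :
    IntervalIntegrable (fun ω => rad i ω * rad j ω) volume 0 1 := by
  rw [intervalIntegrable_iff, uIoc_of_le zero_le_one]
  refine Integrable.of_bound (C := 1)
    ((rad_measurable i).mul (rad_measurable j)).aestronglyMeasurable ?_
  filter_upwards with ω
  rw [Real.norm_eq_abs, abs_mul, abs_rad, abs_rad]; norm_num

theorem radSum_sq (a : ℕ → ℝ) (n : ℕ) (ω : ℝ) : radSum a n ω ^ 2 =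
    ∑ i ∈ Finset.range n, ∑ j ∈ Finset.range n, (a i * a j) * (rad i ω * rad j ω) := by
  rw [pow_two, radSum, Finset.sum_mul_sum]
  refine Finset.sum_congr rfl fun i _ => Finset.sum_congr rfl fun j _ => by ring

theorem integral_radSum_sq (a : ℕ → ℝ) (ha : ∀ i, |a i| ≤ 1) (n : ℕ) :
    ∫ ω in (0:ℝ)..1, radSum a n ω ^ 2 ≤ n := by
  simp_rw [radSum_sq]
  rw [intervalIntegral.integral_finsetSum]
  · have h : ∀ i ∈ Finset.range n, ∫ ω in (0:ℝ)..1, ∑ j ∈ Finset.range n,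
        (a i * a j) * (rad i ω * rad j ω) ≤ 1 := by
      intro i hi
      rw [intervalIntegral.integral_finsetSum
        (fun j _ => (rad_mul_intervalIntegrable i j).const_mul _)]
      simp_rw [intervalIntegral.integral_const_mul, rad_orth]
      simp only [mul_ite, mul_one, mul_zero, Finset.sum_ite_eq, hi, if_true]
      have := abs_le.1 (ha i)
      nlinarith
    exact (Finset.sum_le_sum h).trans (by simp)
  · intro i _
    have := IntervalIntegrable.sum (μ := volume) (a := (0:ℝ)) (b := 1) (Finset.range n)
      (f := fun j ω => (a i * a j) * (rad i ω * rad j ω))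
      (fun j _ => (rad_mul_intervalIntegrable i j).const_mul _)
    refine this.congr ?_
    intro ω _
    simp

theorem abs_radSum_le (a : ℕ → ℝ) (ha : ∀ i, |a i| ≤ 1) (n : ℕ) (ω : ℝ) :
    |radSum a n ω| ≤ n := by
  refine (Finset.abs_sum_le_sum_abs _ _).trans ?_
  have : ∀ i ∈ Finset.range n, |a i * rad i ω| ≤ 1 := fun i _ => by
    rw [abs_mul, abs_rad, mul_one]; exact ha i
  exact (Finset.sum_le_sum this).trans (by simp)

theorem abs_radSum_sub_le (a : ℕ → ℝ) (ha : ∀ i, |a i| ≤ 1) {m n : ℕ} (h : m ≤ n) (ω : ℝ) :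
    |radSum a n ω - radSum a m ω| ≤ n - m := by
  induction n, h using Nat.le_induction with
  | base => simp
  | succ n hn ih =>
    have h1 : radSum a (n+1) ω = radSum a n ω + a n * rad n ω := Finset.sum_range_succ _ _
    have h2 : |a n * rad n ω| ≤ 1 := by rw [abs_mul, abs_rad, mul_one]; exact ha n
    have h3 := abs_add_le (radSum a n ω - radSum a m ω) (a n * rad n ω)
    rw [h1]; push_cast
    rw [show radSum a n ω + a n * rad n ω - radSum a m ω
      = radSum a n ω - radSum a m ω + a n * rad n ω by ring]
    linarith

theorem lintegral_radSum_sq (a : ℕ → ℝ) (ha : ∀ i, |a i| ≤ 1) (n : ℕ) :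
    ∫⁻ ω in Ioc (0:ℝ) 1, ENNReal.ofReal (radSum a n ω ^ 2) ≤ ENNReal.ofReal n := by
  rw [← ofReal_integral_eq_lintegral_ofReal]
  · refine ENNReal.ofReal_le_ofReal ?_
    rw [← intervalIntegral.integral_of_le zero_le_one]
    exact integral_radSum_sq a ha n
  · refine Integrable.of_bound (C := (n:ℝ)^2)
      ((radSum_measurable a n).pow_const 2).aestronglyMeasurable ?_
    filter_upwards with ω
    rw [Real.norm_eq_abs, abs_pow]
    exact pow_le_pow_left₀ (abs_nonneg _) (abs_radSum_le a ha n ω) 2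
  · filter_upwards with ω
    positivity

theorem ae_squares (a : ℕ → ℝ) (ha : ∀ i, |a i| ≤ 1) :
    ∀ᵐ ω ∂(volume.restrict (Ioc (0:ℝ) 1)),
      Tendsto (fun k : ℕ => radSum a ((k+1)^2) ω / ((k:ℝ)+1)^2) atTop (𝓝 0) := by
  have hm : ∀ k : ℕ, Measurable fun ω : ℝ =>
      ENNReal.ofReal ((radSum a ((k+1)^2) ω / ((k:ℝ)+1)^2)^2) := fun k =>
    (((radSum_measurable a _).div_const _).pow_const 2).ennreal_ofReal
  have hfin : ∫⁻ ω in Ioc (0:ℝ) 1, ∑' k : ℕ,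
      ENNReal.ofReal ((radSum a ((k+1)^2) ω / ((k:ℝ)+1)^2)^2) ≠ ⊤ := by
    rw [lintegral_tsum fun k => (hm k).aemeasurable]
    have hs : Summable fun k : ℕ => 1 / ((k:ℝ)+1)^2 := by
      have := (summable_nat_add_iff 1).2 (Real.summable_one_div_nat_pow.2 (by norm_num : 1 < 2))
      simpa using this
    refine ne_top_of_le_ne_top hs.tsum_ofReal_ne_top (ENNReal.tsum_le_tsum fun k => ?_)
    have h0 : (0:ℝ) < (k:ℝ)+1 := by positivity
    have h1 : ∀ ω, ENNReal.ofReal ((radSum a ((k+1)^2) ω / ((k:ℝ)+1)^2)^2) =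
        ENNReal.ofReal (1 / ((k:ℝ)+1)^4) * ENNReal.ofReal (radSum a ((k+1)^2) ω ^ 2) := by
      intro ω
      rw [← ENNReal.ofReal_mul (by positivity)]
      congr 1
      field_simp
    simp_rw [h1]
    rw [lintegral_const_mul _ ((radSum_measurable a _).pow_const 2).ennreal_ofReal]
    refine (mul_le_mul_right (lintegral_radSum_sq a ha _) _).trans ?_
    rw [← ENNReal.ofReal_mul (by positivity)]
    refine ENNReal.ofReal_le_ofReal (le_of_eq ?_)
    push_cast
    field_simp
  filter_upwards [ae_lt_top (Measurable.tsum hm) hfin] with ω hω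
  have h1 := ENNReal.tendsto_atTop_zero_of_tsum_ne_top hω.ne
  have h2 := (ENNReal.tendsto_toReal ENNReal.zero_ne_top).comp h1
  have h3 : Tendsto (fun k : ℕ => (radSum a ((k+1)^2) ω / ((k:ℝ)+1)^2)^2) atTop (𝓝 0) := by
    refine h2.congr fun k => ?_
    simp only [Function.comp]
    rw [ENNReal.toReal_ofReal (by positivity)]
  have h4 := h3.sqrt
  simp only [Real.sqrt_sq_eq_abs, Real.sqrt_zero] at h4
  exact (tendsto_zero_iff_abs_tendsto_zero _).2 h4

theorem ae_slln (a : ℕ → ℝ) (ha : ∀ i, |a i| ≤ 1) :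
    ∀ᵐ ω ∂(volume.restrict (Ioc (0:ℝ) 1)),
      Tendsto (fun n : ℕ => radSum a n ω / n) atTop (𝓝 0) := by
  filter_upwards [ae_squares a ha] with ω hω
  rw [tendsto_zero_iff_abs_tendsto_zero] at hω ⊢
  -- compare with the largest square below
  have hsq : Tendsto (fun n : ℕ => Nat.sqrt n - 1) atTop atTop := by
    rw [tendsto_atTop]
    intro b
    filter_upwards [eventually_ge_atTop ((b+1)*(b+1))] with n hn
    have := Nat.le_sqrt.2 hn
    omega
  have hsqR : Tendsto (fun n : ℕ => 2 * (1 / (((Nat.sqrt n - 1 : ℕ) : ℝ) + 1))) atTop (𝓝 0) := by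
    have := (tendsto_one_div_add_atTop_nhds_zero_nat (𝕜 := ℝ)).comp hsq
    simpa using this.const_mul 2
  have hsum := (hω.comp hsq).add hsqR
  rw [add_zero] at hsum
  refine tendsto_of_tendsto_of_tendsto_of_le_of_le' tendsto_const_nhds hsum ?_ ?_
  · filter_upwards with n using abs_nonneg _
  · filter_upwards [eventually_ge_atTop 1] with n hn
    simp only [Function.comp]
    have hs1 : 1 ≤ Nat.sqrt n := Nat.le_sqrt.2 (by omega)
    obtain ⟨k, hk⟩ : ∃ k, Nat.sqrt n = k + 1 := ⟨Nat.sqrt n - 1, by omega⟩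
    rw [hk]
    simp only [Nat.add_sub_cancel]
    have hle : (k+1)^2 ≤ n := by rw [pow_two, ← hk]; exact Nat.sqrt_le n
    have hlt : n ≤ (k+1)^2 + 2 * (k+1) := by
      have := Nat.sqrt_le_add n; rw [hk] at this; nlinarith
    have h1 := abs_radSum_sub_le a ha hle ω
    have hleR : ((k:ℝ)+1)^2 ≤ n := by exact_mod_cast hle
    have hltR : (n:ℝ) ≤ ((k:ℝ)+1)^2 + 2 * ((k:ℝ)+1) := by exact_mod_cast hlt
    have hk0 : (0:ℝ) < (k:ℝ)+1 := by positivity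
    have h2 : |radSum a n ω| ≤ |radSum a ((k+1)^2) ω| + 2 * ((k:ℝ)+1) := by
      have := abs_sub_abs_le_abs_sub (radSum a n ω) (radSum a ((k+1)^2) ω)
      push_cast at h1
      linarith
    rw [abs_div, abs_div, abs_of_nonneg (by positivity : (0:ℝ) ≤ n),
      abs_of_nonneg (by positivity : (0:ℝ) ≤ ((k:ℝ)+1)^2)]
    calc |radSum a n ω| / n ≤ (|radSum a ((k+1)^2) ω| + 2 * ((k:ℝ)+1)) / ((k:ℝ)+1)^2 := by
          gcongr
      _ = _ := by field_simp

theorem radSum_eq (S : Set ℕ) (n : ℕ) (ω : ℝ) :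
    (cntN ({i | dyadicDigit ω i = 1} ∩ S) n : ℝ) - cntN S n / 2 =
      radSum (S.indicator fun _ => 1) n ω / 2 := by
  classical
  induction n with
  | zero => simp [cntN_zero, radSum]
  | succ n ih =>
    have h1 : radSum (S.indicator fun _ => 1) (n+1) ω =
      radSum (S.indicator fun _ => 1) n ω + (S.indicator (fun _ => 1) n) * rad n ω :=
        Finset.sum_range_succ _ _
    rw [h1, add_div, ← ih, cntN_succ, cntN_succ]
    unfold rad
    by_cases hS : n ∈ S <;> by_cases hd : Even ⌈(2:ℝ) ^ (n+1) * ω⌉ <;>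
      simp [hS, hd, digit_eq_one_iff] <;> ring

theorem ae_density (S : Set ℕ) : ∀ᵐ ω ∂(volume.restrict (Ioc (0:ℝ) 1)),
    Tendsto (fun n : ℕ => ((cntN ({i | dyadicDigit ω i = 1} ∩ S) n : ℝ) - cntN S n / 2) / n)
      atTop (𝓝 0) := by
  have ha : ∀ i, |S.indicator (fun _ => (1:ℝ)) i| ≤ 1 := by
    intro i
    by_cases h : i ∈ S <;> simp [h]
  filter_upwards [ae_slln _ ha] with ω hω
  have := hω.div_const 2
  rw [zero_div] at this
  refine this.congr fun n => ?_
  rw [radSum_eq, div_right_comm]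

/-- For a sequence `x` in a separable metric space, the set of statistical
limit points of `x` (`I_0`-limit points, where `I_0` is the ideal of sets of zero asymptotic
density) equals the set of statistical limit points of almost every subsequence. -/
theorem stmt5 {X : Type*} [MetricSpace X] [TopologicalSpace.SeparableSpace X] (x : ℕ → X) :
    volume {ω ∈ Set.Ioc (0 : ℝ) 1 |
      idealLimitPoints {S : Set ℕ | HasDensity S 0} x
        = idealLimitPoints {S : Set ℕ | HasDensity S 0} (subseq x ω)} = 1 := by
  have : SecondCountableTopology X := UniformSpace.secondCountable_of_separable X
  have hBc := TopologicalSpace.countable_countableBasis X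
  have hB := TopologicalSpace.isBasis_countableBasis X
  have h1 : ∀ᵐ ω ∂(volume.restrict (Ioc (0:ℝ) 1)), ∀ U ∈ TopologicalSpace.countableBasis X,
      Tendsto (fun n : ℕ => ((cntN ({i | dyadicDigit ω i = 1} ∩ {i | x i ∈ U}) n : ℝ)
        - cntN {i | x i ∈ U} n / 2) / n) atTop (𝓝 0) :=
    (ae_ball_iff hBc).2 fun U _ => ae_density _
  have h2 : ∀ᵐ ω ∂(volume.restrict (Ioc (0:ℝ) 1)),
      idealLimitPoints {S : Set ℕ | HasDensity S 0} x
        = idealLimitPoints {S : Set ℕ | HasDensity S 0} (subseq x ω) := by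
    filter_upwards [h1, ae_density Set.univ] with ω hω hu
    refine limitPoints_eq x {i | dyadicDigit ω i = 1} _ hB ?_ hω
    have huniv : ∀ n, cntN Set.univ n = n := fun n => by simp [cntN]
    simpa [huniv] using hu
  rw [ae_restrict_iff' measurableSet_Ioc] at h2
  have h3 : {ω ∈ Set.Ioc (0 : ℝ) 1 | idealLimitPoints {S : Set ℕ | HasDensity S 0} x
        = idealLimitPoints {S : Set ℕ | HasDensity S 0} (subseq x ω)} =ᵐ[volume]
      Set.Ioc (0 : ℝ) 1 := by
    filter_upwards [h2] with ω hω
    exact propext ⟨fun h => h.1, fun h => ⟨h, hω h⟩⟩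
  rw [measure_congr h3]
  simp
end
end

section
/- Let α ≥ -1 be a real number and let x = (x_n) be the real sequence with x_1 = 1 and x_n = 1/f(n) for n ≥ 2, where f(n) denotes the least prime factor of n. Then for every prime p, the point 1/p is an I_α-limit point of x, where I_α := {S ⊆ ℕ : d_α^⋆(S) = 0}. In fact, the set A := pℕ \ ⋃_{q < p, q prime} qℕ satisfies x_n = 1/p for all n ∈ A, and A has α-asymptotic density (1/p)∏_{q<p, q prime}(1 − 1/q) > 0. -/
open Filter Topology MeasureTheory Set

noncomputable section

/-- The set `A = pℕ \\ ⋃_{q < p prime} qℕ` of positive multiples of `p` not divisible by any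
smaller prime. -/
def leastPrimeFacSet (p : ℕ) : Set ℕ :=
  {n : ℕ | 0 < n ∧ p ∣ n ∧ ∀ q : ℕ, q.Prime → q < p → ¬ q ∣ n}

def wsum (α : ℝ) (n : ℕ) : ℝ := ∑ i ∈ Finset.Icc 1 n, (i : ℝ) ^ α

theorem wsum_tendsto (α : ℝ) (hα : -1 ≤ α) : Tendsto (wsum α) atTop atTop := by
  have h : ¬ Summable (fun n : ℕ => (n : ℝ) ^ α) := by
    rw [Real.summable_nat_rpow]; linarith
  have h0 : ¬ Summable (fun n : ℕ => ((n + 1 : ℕ) : ℝ) ^ α) := by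
    rwa [summable_nat_add_iff 1 (f := fun n : ℕ => (n : ℝ) ^ α)]
  rw [not_summable_iff_tendsto_nat_atTop_of_nonneg (fun n => by positivity)] at h0
  refine h0.congr fun n => ?_
  unfold wsum
  induction n with
  | zero => simp
  | succ k ih => rw [Finset.sum_range_succ, ih, Finset.sum_Icc_succ_top (by omega)]

theorem wsum_lower (α : ℝ) (hα : 0 ≤ α) (n : ℕ) :
    (n : ℝ) ^ α * n / (α + 1) ≤ wsum α n := by
  unfold wsum
  induction n with
  | zero => simp
  | succ k ih =>
    rw [Finset.sum_Icc_succ_top (by omega)]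
    refine le_trans ?_ (add_le_add_left ih _)
    have hb := one_add_mul_self_le_rpow_one_add (s := -1 / ((k : ℝ) + 1)) (p := α + 1)
      (by rw [le_div_iff₀ (by positivity)]; linarith [(k.cast_nonneg : (0:ℝ) ≤ k)]) (by linarith)
    have e : 1 + -1 / ((k : ℝ) + 1) = k / (k + 1) := by field_simp; ring
    rw [e, Real.div_rpow (by positivity) (by positivity),
      Real.rpow_add_one' (by positivity) (by positivity),
      Real.rpow_add_one' (by positivity) (by positivity)] at hb
    have hk : 0 < ((k : ℝ) + 1) ^ α := by positivity
    rw [le_div_iff₀ (by positivity)] at hb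
    push_cast
    rw [div_add' _ _ _ (by positivity), div_le_div_iff_of_pos_right (by positivity)]
    have : (1 + (α + 1) * (-1 / ((k : ℝ) + 1))) * (((k : ℝ) + 1) ^ α * (k + 1)) =
      ((k : ℝ) + 1) ^ α * (k + 1) - (α + 1) * ((k : ℝ) + 1) ^ α := by
      field_simp; ring
    rw [this] at hb
    linarith

theorem pow_div_wsum (α : ℝ) (hα : -1 ≤ α) :
    Tendsto (fun n : ℕ => (n : ℝ) ^ α / wsum α n) atTop (𝓝 0) := by
  rcases le_total 0 α with h | h
  · have h1 : Tendsto (fun n : ℕ => (α + 1) / (n : ℝ)) atTop (𝓝 0) :=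
      tendsto_const_div_atTop_nhds_zero_nat _
    refine squeeze_zero' (Eventually.of_forall fun n => ?_) ?_ h1
    · unfold wsum; positivity
    · filter_upwards [eventually_ge_atTop 1, (wsum_tendsto α hα).eventually_gt_atTop 0] with n hn hw
      have hn' : (0 : ℝ) < n := by exact_mod_cast hn
      have := wsum_lower α h n
      rw [div_le_iff₀ (by positivity)] at this
      rw [div_le_div_iff₀ hw hn']
      linarith
  · have h1 : Tendsto (fun n : ℕ => 1 / wsum α n) atTop (𝓝 0) :=
      tendsto_const_nhds.div_atTop (wsum_tendsto α hα)
    refine squeeze_zero' (Eventually.of_forall fun n => ?_) ?_ h1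
    · unfold wsum; positivity
    · filter_upwards [eventually_ge_atTop 1, (wsum_tendsto α hα).eventually_gt_atTop 0] with n hn hw
      have hn' : (1 : ℝ) ≤ n := by exact_mod_cast hn
      gcongr
      exact Real.rpow_le_one_of_one_le_of_nonpos hn' h

theorem abel_bound (α : ℝ) (m : ℕ) (hm : 0 < m) (s : ℝ)
    (hs : ∀ n : ℕ, 1 ≤ n → |(n : ℝ) ^ α - ((n + 1 : ℕ) : ℝ) ^ α| ≤
      s * (((n + 1 : ℕ) : ℝ) ^ α - (n : ℝ) ^ α)) (n : ℕ) (hn : 1 ≤ n) :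
    |(∑ i ∈ Finset.Icc 1 n, ({i : ℕ | m ∣ i}.indicator (fun i => (i : ℝ) ^ α) i)) -
      (1 / (m : ℝ)) * wsum α n - (((n / m : ℕ) : ℝ) - n / m) * (n : ℝ) ^ α|
      ≤ s * ((n : ℝ) ^ α - 1) := by
  have hm' : (0 : ℝ) < m := by exact_mod_cast hm
  unfold wsum
  induction n, hn using Nat.le_induction with
  | base =>
    have hd := Nat.succ_div (a := 0) (b := m)
    simp only [Nat.succ_eq_add_one, zero_add, Nat.zero_div] at hd
    rw [hd]
    by_cases h : m ∣ 1
    · simp [Set.indicator, h]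
    · simp [Set.indicator, h]
  | succ k hk ih =>
    rw [Finset.sum_Icc_succ_top (by omega), Finset.sum_Icc_succ_top (by omega)]
    have hC : |((k / m : ℕ) : ℝ) - k / m| ≤ 1 := by
      have h1 : ((k / m : ℕ) : ℝ) ≤ k / m := Nat.cast_div_le
      have h2 : (k : ℝ) / m < (k / m : ℕ) + 1 := by
        rw [div_lt_iff₀ hm']
        have := Nat.lt_mul_div_succ k hm
        rw [mul_comm]
        exact_mod_cast this
      rw [abs_le]; constructor <;> linarith
    have key : {i : ℕ | m ∣ i}.indicator (fun i => (i : ℝ) ^ α) (k + 1) =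
        ((((k + 1) / m : ℕ) : ℝ) - ((k / m : ℕ) : ℝ)) * ((k + 1 : ℕ) : ℝ) ^ α := by
      rw [Nat.succ_div]
      by_cases h : m ∣ k + 1 <;> simp [Set.indicator, h]
    rw [key]
    have h3 := hs k hk
    have h4 : |(((k / m : ℕ) : ℝ) - k / m) * ((k : ℝ) ^ α - ((k + 1 : ℕ) : ℝ) ^ α)| ≤
        s * (((k + 1 : ℕ) : ℝ) ^ α - (k : ℝ) ^ α) := by
      rw [abs_mul]
      exact (mul_le_of_le_one_left (abs_nonneg _) hC).trans h3
    have h5 := (abs_add_le _ _).trans (add_le_add ih h4)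
    refine le_trans (le_of_eq ?_) (h5.trans (le_of_eq ?_))
    · congr 1
      push_cast
      ring
    · ring

theorem mult_density (α : ℝ) (hα : -1 ≤ α) (m : ℕ) (hm : 0 < m) :
    HasAlphaDensity α {i : ℕ | m ∣ i} (1 / (m : ℝ)) := by
  have hm' : (0 : ℝ) < m := by exact_mod_cast hm
  unfold HasAlphaDensity
  rw [tendsto_iff_norm_sub_tendsto_zero]
  have hlim : Tendsto (fun n : ℕ => 2 * ((n : ℝ) ^ α / wsum α n) + 1 / wsum α n) atTop (𝓝 0) := by
    have := ((pow_div_wsum α hα).const_mul 2).add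
      (tendsto_const_nhds (x := (1 : ℝ)) |>.div_atTop (wsum_tendsto α hα))
    simpa using this
  refine squeeze_zero' (Eventually.of_forall fun n => norm_nonneg _) ?_ hlim
  filter_upwards [eventually_ge_atTop 1, (wsum_tendsto α hα).eventually_gt_atTop 0] with n hn hw
  change ‖_ / wsum α n - _‖ ≤ _
  have hb : |(∑ i ∈ Finset.Icc 1 n, ({i : ℕ | m ∣ i}.indicator (fun i => (i : ℝ) ^ α) i)) -
      (1 / (m : ℝ)) * wsum α n - (((n / m : ℕ) : ℝ) - n / m) * (n : ℝ) ^ α|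
      ≤ (n : ℝ) ^ α + 1 := by
    have hp : 0 ≤ (n : ℝ) ^ α := by positivity
    rcases le_total 0 α with h | h
    · refine (abel_bound α m hm 1 (fun k hk => ?_) n hn).trans (by linarith)
      have : (k : ℝ) ^ α ≤ ((k + 1 : ℕ) : ℝ) ^ α :=
        Real.rpow_le_rpow (by positivity) (by push_cast; linarith) h
      rw [abs_of_nonpos (by linarith)]; linarith
    · refine (abel_bound α m hm (-1) (fun k hk => ?_) n hn).trans (by linarith)
      have : ((k + 1 : ℕ) : ℝ) ^ α ≤ (k : ℝ) ^ α :=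
        Real.rpow_le_rpow_of_nonpos (by exact_mod_cast hk) (by push_cast; linarith) h
      rw [abs_of_nonneg (by linarith)]; linarith
  have hC : |((n / m : ℕ) : ℝ) - n / m| ≤ 1 := by
    have h1 : ((n / m : ℕ) : ℝ) ≤ n / m := Nat.cast_div_le
    have h2 : (n : ℝ) / m < (n / m : ℕ) + 1 := by
      rw [div_lt_iff₀ hm']
      have := Nat.lt_mul_div_succ n hm
      rw [mul_comm]
      exact_mod_cast this
    rw [abs_le]; constructor <;> linarith
  have h4 : |(((n / m : ℕ) : ℝ) - n / m) * (n : ℝ) ^ α| ≤ (n : ℝ) ^ α := by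
    rw [abs_mul, abs_of_nonneg (by positivity : 0 ≤ (n : ℝ) ^ α)]
    exact mul_le_of_le_one_left (by positivity) hC
  have h5 := (abs_add_le _ _).trans (add_le_add hb h4)
  rw [sub_add_cancel] at h5
  rw [Real.norm_eq_abs, div_sub' hw.ne', abs_div, abs_of_pos hw, ← mul_div_assoc 2, ← add_div]
  gcongr
  rw [mul_comm (wsum α n)]
  linarith

theorem sieve_density (α : ℝ) (hα : -1 ≤ α) (Q : Finset ℕ) (hQ : ∀ q ∈ Q, q.Prime) :
    ∀ m : ℕ, 0 < m → (∀ q ∈ Q, ¬ q ∣ m) →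
    HasAlphaDensity α {i : ℕ | m ∣ i ∧ ∀ q ∈ Q, ¬ q ∣ i}
      ((1 / (m : ℝ)) * ∏ q ∈ Q, (1 - 1 / (q : ℝ))) := by
  induction Q using Finset.induction_on with
  | empty =>
    intro m hm _
    simpa using mult_density α hα m hm
  | insert q Q hq ih =>
    intro m hm hmQ
    have hqp : q.Prime := hQ q (by simp)
    have ih' := ih (fun r hr => hQ r (by simp [hr]))
    have h1 := ih' m hm (fun r hr => hmQ r (by simp [hr]))
    have h2 := ih' (m * q) (Nat.mul_pos hm hqp.pos) (fun r hr hd => by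
      have hrp : r.Prime := hQ r (by simp [hr])
      rcases hrp.dvd_mul.1 hd with h | h
      · exact hmQ r (by simp [hr]) h
      · exact hq (((Nat.prime_dvd_prime_iff_eq hrp hqp).1 h) ▸ hr))
    have h3 := Tendsto.sub h1 h2
    unfold HasAlphaDensity
    have e : (1 / (m : ℝ)) * ∏ r ∈ insert q Q, (1 - 1 / (r : ℝ)) =
        (1 / (m : ℝ)) * ∏ r ∈ Q, (1 - 1 / (r : ℝ)) -
        (1 / ((m * q : ℕ) : ℝ)) * ∏ r ∈ Q, (1 - 1 / (r : ℝ)) := by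
      rw [Finset.prod_insert hq]
      have : (m : ℝ) ≠ 0 := by exact_mod_cast hm.ne'
      have : (q : ℝ) ≠ 0 := by exact_mod_cast hqp.ne_zero
      push_cast
      field_simp
    rw [e]
    refine h3.congr fun n => ?_
    rw [← sub_div, ← Finset.sum_sub_distrib]
    congr 1
    refine Finset.sum_congr rfl fun i _ => ?_
    have hcop : Nat.Coprime m q :=
      ((Nat.Prime.coprime_iff_not_dvd hqp).2 (hmQ q (by simp))).symm
    have hdv : m * q ∣ i ↔ m ∣ i ∧ q ∣ i :=
      ⟨fun h => ⟨(Dvd.intro _ rfl).trans h, (Dvd.intro_left _ rfl).trans h⟩,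
        fun h => hcop.mul_dvd_of_dvd_of_dvd h.1 h.2⟩
    simp only [Set.indicator, Set.mem_ofPred_eq, Finset.forall_mem_insert, hdv]
    by_cases a : m ∣ i <;> by_cases b : q ∣ i <;> by_cases c : ∀ r ∈ Q, ¬ r ∣ i <;> simp [a, b, c]

/-- For the sequence `x_1 = 1`, `x_n = 1/(least prime factor of n)` and any
prime `p`, the point `1/p` is an `I_α`-limit point of `x`; indeed `x_n = 1/p` on the set
`A = pℕ \\ ⋃_{q<p prime} qℕ`, which has `α`-asymptotic density
`(1/p)∏_{q<p prime}(1 - 1/q) > 0`. -/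
theorem stmt10 (α : ℝ) (hα : -1 ≤ α) (x : ℕ → ℝ) (hx1 : x 1 = 1)
    (hx : ∀ n : ℕ, 2 ≤ n → x n = 1 / (n.minFac : ℝ)) (p : ℕ) (hp : p.Prime) :
    (1 / (p : ℝ)) ∈ idealLimitPoints (Ialpha α) x ∧
    (∀ n ∈ leastPrimeFacSet p, x n = 1 / (p : ℝ)) ∧
    HasAlphaDensity α (leastPrimeFacSet p)
      ((1 / (p : ℝ)) * ∏ q ∈ (Finset.range p).filter Nat.Prime, (1 - 1 / (q : ℝ))) ∧
    0 < (1 / (p : ℝ)) * ∏ q ∈ (Finset.range p).filter Nat.Prime, (1 - 1 / (q : ℝ)) := by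
  have hpos : 0 < (1 / (p : ℝ)) * ∏ q ∈ (Finset.range p).filter Nat.Prime, (1 - 1 / (q : ℝ)) := by
    have hp0 : (0 : ℝ) < p := by exact_mod_cast hp.pos
    refine mul_pos (by positivity) (Finset.prod_pos fun q hq => ?_)
    have hq1 : (1 : ℝ) < q := by exact_mod_cast (Finset.mem_filter.1 hq).2.one_lt
    rw [sub_pos, div_lt_one (by linarith)]
    exact hq1
  have hval : ∀ n ∈ leastPrimeFacSet p, x n = 1 / (p : ℝ) := by
    rintro n ⟨hn, hpn, hq⟩
    have h2 : 2 ≤ n := hp.two_le.trans (Nat.le_of_dvd hn hpn)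
    rw [hx n h2]
    have hle : n.minFac ≤ p := Nat.minFac_le_of_dvd hp.two_le hpn
    have hge : ¬ n.minFac < p := fun h =>
      hq _ (Nat.minFac_prime (by omega)) h (Nat.minFac_dvd n)
    rw [show n.minFac = p by omega]
  have hden : HasAlphaDensity α (leastPrimeFacSet p)
      ((1 / (p : ℝ)) * ∏ q ∈ (Finset.range p).filter Nat.Prime, (1 - 1 / (q : ℝ))) := by
    have h := sieve_density α hα ((Finset.range p).filter Nat.Prime)
      (fun q hq => (Finset.mem_filter.1 hq).2) p hp.pos (fun q hq hd => by
        rw [Finset.mem_filter, Finset.mem_range] at hq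
        have := (Nat.prime_dvd_prime_iff_eq hq.2 hp).1 hd
        omega)
    refine Tendsto.congr (fun n => ?_) h
    congr 1
    refine Finset.sum_congr rfl fun i hi => ?_
    have hi0 : 0 < i := (Finset.mem_Icc.1 hi).1
    have hiff : i ∈ {i : ℕ | p ∣ i ∧ ∀ q ∈ (Finset.range p).filter Nat.Prime, ¬ q ∣ i} ↔
        i ∈ leastPrimeFacSet p := by
      simp only [leastPrimeFacSet, Set.mem_ofPred_eq, Finset.mem_filter, Finset.mem_range]
      constructor
      · rintro ⟨a, b⟩
        exact ⟨hi0, a, fun q h1 h2 => b q ⟨h2, h1⟩⟩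
      · rintro ⟨_, a, b⟩
        exact ⟨a, fun q h => b q h.2 h.1⟩
    by_cases hm : i ∈ leastPrimeFacSet p
    · rw [Set.indicator_of_mem hm, Set.indicator_of_mem (hiff.2 hm)]
    · rw [Set.indicator_of_notMem hm, Set.indicator_of_notMem (fun h => hm (hiff.1 h))]
  refine ⟨⟨leastPrimeFacSet p, ?_, ?_⟩, hval, hden, hpos⟩
  · intro h
    have h1 : upperAlphaDensity α (leastPrimeFacSet p) = 0 := h
    have h2 : upperAlphaDensity α (leastPrimeFacSet p) = _ := Tendsto.limsup_eq hden
    rw [h2] at h1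
    exact hpos.ne' h1
  · refine tendsto_const_nhds.congr' ?_
    have : ∀ᶠ n in atTop ⊓ 𝓟 (leastPrimeFacSet p), n ∈ leastPrimeFacSet p :=
      mem_inf_of_right (mem_principal_self _)
    filter_upwards [this] with n hn
    exact (hval n hn).symm
end
end

section
/- Let α ≥ -1 be a real number and let x = (x_n) be the real sequence with x_1 = 1 and x_n = 1/f(n) for n ≥ 2, where f(n) denotes the least prime factor of n. Then 0 is not an I_α-limit point of x: for every subsequence (x_{n_k}) converging to 0, the index set {n_k : k ∈ ℕ} belongs to I_α := {S ⊆ ℕ : d_α^⋆(S) = 0}. -/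
open Filter Topology MeasureTheory Set

noncomputable section

lemma aux_totient (ε : ℝ) (hε : 0 < ε) : ∃ P : ℕ,
    ((primorial P).totient : ℝ) / (primorial P : ℝ) < ε := by
  have h1 := (not_summable_iff_tendsto_nat_atTop_of_nonneg (f := indicator {p | p.Prime}
    (fun n : ℕ ↦ (1 : ℝ) / n)) (fun n => Set.indicator_nonneg (fun _ _ => by positivity) _)).1
    not_summable_one_div_on_primes
  have h2 := (Real.tendsto_exp_neg_atTop_nhds_zero.comp h1).comp (tendsto_add_atTop_nat 1)
  obtain ⟨P, hP⟩ := (h2.eventually (gt_mem_nhds hε)).exists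
  refine ⟨P, lt_of_le_of_lt ?_ hP⟩
  have hpos : (0 : ℝ) < (primorial P : ℝ) := by exact_mod_cast primorial_pos P
  have h3 : ((primorial P).totient : ℝ)
      = (primorial P : ℝ) * ∏ p ∈ (primorial P).primeFactors, (1 - (p : ℝ)⁻¹) := by
    have := Nat.totient_eq_mul_prod_factors (primorial P)
    have h := congrArg (fun q : ℚ => (q : ℝ)) this
    push_cast at h
    exact h
  rw [h3, mul_div_cancel_left₀ _ hpos.ne', primeFactors_primorial, Nat.primesLE_eq_filter_range]
  simp only [Function.comp]
  rw [← Finset.sum_neg_distrib, Real.exp_sum, Finset.prod_filter]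
  refine Finset.prod_le_prod ?_ ?_
  · intro i _
    split_ifs with h
    · have : (1 : ℝ) ≤ i := by exact_mod_cast h.one_le
      have := inv_le_one_of_one_le₀ this
      linarith
    · norm_num
  · intro i _
    by_cases h : i.Prime
    · have := Real.add_one_le_exp (-(1 / (i : ℝ)))
      simp only [Set.indicator, Set.mem_setOf_eq, h, if_true]
      rw [one_div] at *
      linarith
    · simp [h]

lemma aux_weight (α : ℝ) (i m : ℕ) (hm : 0 < m) (h1 : m ≤ i) (h2 : i ≤ 2 * m) :
    (i : ℝ) ^ α ≤ 2 ^ |α| * (m : ℝ) ^ α := by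
  have hm' : (0 : ℝ) < m := by exact_mod_cast hm
  have h1' : (m : ℝ) ≤ i := by exact_mod_cast h1
  have h2' : (i : ℝ) ≤ 2 * m := by exact_mod_cast h2
  rcases le_total 0 α with h | h
  · rw [abs_of_nonneg h, ← Real.mul_rpow (by norm_num) hm'.le]
    exact Real.rpow_le_rpow (by positivity) h2' h
  · have h3 : (i : ℝ) ^ α ≤ (m : ℝ) ^ α := Real.rpow_le_rpow_of_nonpos hm' h1' h
    have h4 : (1 : ℝ) ≤ 2 ^ |α| := Real.one_le_rpow (by norm_num) (abs_nonneg _)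
    have h5 : (0 : ℝ) ≤ (m : ℝ) ^ α := by positivity
    nlinarith

lemma aux_W (α : ℝ) (hα : -1 ≤ α) :
    Tendsto (fun n : ℕ => ∑ i ∈ Finset.Icc 1 n, (i : ℝ) ^ α) atTop atTop := by
  refine tendsto_atTop_mono ?_ Real.tendsto_sum_range_one_div_nat_succ_atTop
  intro n
  rw [Finset.range_eq_Ico, Finset.sum_Ico_add' (fun i : ℕ => (i : ℝ) ^ α) 0 n 1 |>.symm.trans rfl |> fun h => (show ∑ i ∈ Finset.Icc 1 n, (i : ℝ) ^ α = ∑ i ∈ Finset.Ico 0 n, ((i + 1 : ℕ) : ℝ) ^ α from h)]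
  refine Finset.sum_le_sum fun i _ => ?_
  push_cast
  rw [one_div, ← Real.rpow_neg_one]
  exact Real.rpow_le_rpow_of_exponent_le (by linarith [(Nat.cast_nonneg i : (0 : ℝ) ≤ i)]) hα

lemma aux_sum (α : ℝ) (S : Set ℕ) (M K : ℕ) (hM : 0 < M) (hK : 2 * M ≤ K)
    (hS : ∀ i ∈ S, K < i → M.Coprime i) (n : ℕ) :
    ∑ i ∈ Finset.Icc 1 n, S.indicator (fun i => (i : ℝ) ^ α) i ≤
      ∑ i ∈ Finset.Icc 1 K, (i : ℝ) ^ α +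
      (2 ^ |α| * ((M.totient : ℝ) / M)) * ∑ i ∈ Finset.Icc 1 n, (i : ℝ) ^ α := by
  classical
  have hM' : (0 : ℝ) < M := by exact_mod_cast hM
  set w : ℕ → ℝ := fun i => (i : ℝ) ^ α with hw
  have hw0 : ∀ i, 0 ≤ w i := fun i => by simp only [hw]; positivity
  set T := (Finset.Icc 1 n).filter (fun i => K < i ∧ M.Coprime i) with hT
  have h1 : ∑ i ∈ Finset.Icc 1 n, S.indicator w i ≤
      ∑ i ∈ Finset.Icc 1 K, w i + ∑ i ∈ T, w i := by
    have : ∑ i ∈ Finset.Icc 1 n, S.indicator w i ≤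
        ∑ i ∈ (Finset.Icc 1 n).filter (fun i => i ≤ K), w i + ∑ i ∈ T, w i := by
      rw [hT, Finset.sum_filter, Finset.sum_filter, ← Finset.sum_add_distrib]
      refine Finset.sum_le_sum fun i _ => ?_
      by_cases hi : i ∈ S
      · rw [Set.indicator_of_mem hi]
        by_cases hk : i ≤ K
        · rw [if_pos hk, if_neg (fun h => absurd h.1 (not_lt.2 hk)), add_zero]
        · rw [if_neg hk, if_pos ⟨not_le.1 hk, hS i hi (not_le.1 hk)⟩, zero_add]
      · rw [Set.indicator_of_notMem hi]
        have := hw0 i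
        split_ifs <;> linarith
    refine this.trans (add_le_add_left (Finset.sum_le_sum_of_subset_of_nonneg ?_ ?_) _)
    · intro i; simp; omega
    · intro i _ _; exact hw0 i
  refine h1.trans (add_le_add_right ?_ _)
  have h2 : ∀ i ∈ T, w i ≤ 2 ^ |α| / M *
      ∑ m ∈ Finset.Icc 1 n, if m ≤ i ∧ i < m + M then w m else 0 := by
    intro i hi
    simp only [hT, Finset.mem_filter, Finset.mem_Icc] at hi
    have e : (Finset.Icc 1 n).filter (fun m => m ≤ i ∧ i < m + M) = Finset.Ioc (i - M) i := by
      ext m; simp; omega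
    rw [← Finset.sum_filter, e]
    have h3 : (M : ℝ) * w i ≤ ∑ m ∈ Finset.Ioc (i - M) i, 2 ^ |α| * w m := by
      have := Finset.card_nsmul_le_sum (Finset.Ioc (i - M) i) (fun m => 2 ^ |α| * w m) (w i) (by
        intro m hm
        rw [Finset.mem_Ioc] at hm
        exact aux_weight α i m (by omega) (by omega) (by omega))
      rw [Nat.card_Ioc, nsmul_eq_mul] at this
      have e2 : i - (i - M) = M := by omega
      rwa [e2] at this
    rw [← Finset.mul_sum] at h3
    rw [div_mul_eq_mul_div, le_div_iff₀ hM']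
    linarith
  refine (Finset.sum_le_sum h2).trans ?_
  rw [← Finset.mul_sum, Finset.sum_comm]
  have h4 : ∀ m ∈ Finset.Icc 1 n, (∑ i ∈ T, if m ≤ i ∧ i < m + M then w m else 0) ≤
      (M.totient : ℝ) * w m := by
    intro m _
    rw [← Finset.sum_filter, Finset.sum_const, nsmul_eq_mul]
    refine mul_le_mul_of_nonneg_right ?_ (hw0 m)
    rw [← Nat.filter_coprime_Ico_eq_totient M m]
    norm_cast
    refine Finset.card_le_card ?_
    intro i
    simp only [hT, Finset.mem_filter, Finset.mem_Ico]
    tauto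
  have h5 := Finset.sum_le_sum h4
  rw [← Finset.mul_sum] at h5
  calc _ ≤ 2 ^ |α| / (M : ℝ) * ((M.totient : ℝ) * ∑ i ∈ Finset.Icc 1 n, w i) :=
        mul_le_mul_of_nonneg_left h5 (by positivity)
    _ = _ := by ring

lemma aux_main (α : ℝ) (hα : -1 ≤ α) (x : ℕ → ℝ)
    (hx : ∀ n : ℕ, 2 ≤ n → x n = 1 / (n.minFac : ℝ)) (A : Set ℕ)
    (hA : ConvergesAlong x A 0) : A ∈ Ialpha α := by
  show upperAlphaDensity α A = 0
  refine Tendsto.limsup_eq ?_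
  have hcop : ∀ P : ℕ, ∃ N, ∀ i ∈ A, N < i → (primorial P).Coprime i := by
    intro P
    have h1 := hA.eventually (gt_mem_nhds (show (0 : ℝ) < 1 / ((P : ℝ) + 1) by positivity))
    rw [eventually_inf_principal, eventually_atTop] at h1
    obtain ⟨N, hN⟩ := h1
    refine ⟨N + 1, fun i hi hNi => ?_⟩
    have h2 := hN i (by omega) hi
    rw [hx i (by omega)] at h2
    have hmp : (0 : ℝ) < i.minFac := by exact_mod_cast Nat.minFac_pos i
    rw [one_div_lt_one_div hmp (by positivity)] at h2
    have h3 : P + 1 < i.minFac := by exact_mod_cast h2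
    refine Nat.Coprime.prod_left fun p hp => ?_
    rw [Finset.mem_filter, Finset.mem_range] at hp
    exact (Nat.coprime_of_lt_minFac hp.2.ne_zero (by omega)).symm
  have hW := aux_W α hα
  have hW0 : ∀ n : ℕ, 0 ≤ ∑ i ∈ Finset.Icc 1 n, (i : ℝ) ^ α :=
    fun n => Finset.sum_nonneg fun i _ => by positivity
  rw [Metric.tendsto_atTop']
  intro ε hε
  have hC : (0 : ℝ) < 2 ^ |α| := by positivity
  obtain ⟨P, hP⟩ := aux_totient (ε / 2 / 2 ^ |α|) (by positivity)
  obtain ⟨N, hN⟩ := hcop P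
  set M := primorial P with hM
  have hs := aux_sum α A M (max N (2 * M)) (primorial_pos P) (le_max_right _ _)
    (fun i hi h => hN i hi (lt_of_le_of_lt (le_max_left _ _) h))
  set c := ∑ i ∈ Finset.Icc 1 (max N (2 * M)), (i : ℝ) ^ α
  obtain ⟨n0, hn0⟩ := eventually_atTop.1
    ((hW.eventually_gt_atTop (c / (ε / 2))).and (hW.eventually_gt_atTop 0))
  refine ⟨n0, fun n hn => ?_⟩
  obtain ⟨h1, h2⟩ := hn0 n hn.le
  rw [div_lt_iff₀ (by positivity)] at h1
  rw [lt_div_iff₀ hC] at hP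
  have hnn : 0 ≤ ∑ i ∈ Finset.Icc 1 n, A.indicator (fun i => (i : ℝ) ^ α) i :=
    Finset.sum_nonneg fun i _ => Set.indicator_nonneg (fun _ _ => by positivity) _
  rw [Real.dist_eq, sub_zero, abs_of_nonneg (div_nonneg hnn h2.le), div_lt_iff₀ h2]
  have := hs n
  nlinarith [mul_lt_mul_of_pos_right hP h2]


/-- For the sequence `x_1 = 1`, `x_n = 1/(least prime factor of n)`,
the point `0` is not an `I_α`-limit point of `x`: every subsequence converging to `0`
has index set of zero upper `α`-density. -/
theorem stmt11 (α : ℝ) (hα : -1 ≤ α) (x : ℕ → ℝ) (hx1 : x 1 = 1)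
    (hx : ∀ n : ℕ, 2 ≤ n → x n = 1 / (n.minFac : ℝ)) :
    (0 : ℝ) ∉ idealLimitPoints (Ialpha α) x ∧
    ∀ k : ℕ → ℕ, StrictMono k → Tendsto (fun i => x (k i)) atTop (𝓝 (0 : ℝ)) →
      Set.range k ∈ Ialpha α := by
  refine ⟨fun ⟨A, hA, h⟩ => hA (aux_main α hα x hx A h), fun k hk h => ?_⟩
  refine aux_main α hα x hx _ ?_
  intro U hU
  have h1 := h hU
  rw [Filter.mem_map, mem_atTop_sets] at h1
  obtain ⟨I, hI⟩ := h1
  rw [Filter.mem_map, mem_inf_principal, mem_atTop_sets]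
  refine ⟨k I, ?_⟩
  rintro _ hn ⟨i, rfl⟩
  exact hI i (hk.le_iff_le.1 hn)
end
end
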